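/- Fix an integer l with |l| < l₁, a constant w ∈ ℂ, and an admissible sequence d. Then for every real s > 0 the series G(s) = Σ_{(n,m) ∈ ℤ×ℕ, n+m ≤ -l₁} q^{-m} d_m (c² q^{-1})^n (c q^{-1/2})^m w · (q^{s(-2n-m-2l)} - q^{s(-2n-m)}) converges absolutely, and lim_{s→0⁺} s·G(s) = 0. -/

import Mathlib

open Filter Topology

noncomputable section

/-- `qc q x` is the real power `q ^ x`, viewed as a complex number. -/
def qc (q : ℝ) (x : ℝ) : ℂ := ((q ^ x : ℝ) : ℂ)

/-- An admissible sequence: `d m = q^(m/2) (c₁ c^m + c₂ c^(-m))` for all `m ≥ l₁`. -/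
def IsAdmissibleSeq (q : ℝ) (c : ℂ) (l₁ : ℤ) (d : ℕ → ℂ) : Prop :=
  ∃ c₁ c₂ : ℂ, ∀ m : ℕ, l₁ ≤ (m : ℤ) →
    d m = qc q ((m : ℝ) / 2) * (c₁ * c ^ (m : ℤ) + c₂ * c ^ (-(m : ℤ)))

/-- An admissible family on `ℤ × ℕ`, given by region asymptotics. -/
def IsAdmissibleFam (q : ℝ) (l₁ : ℤ) (a : ℤ → ℕ → ℂ) : Prop :=
  ∃ (k₁ k₂ k₃ : ℂ) (A B : ℤ → ℂ), ∀ (n : ℤ) (m : ℕ),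
    (l₁ ≤ n → a n m = k₁) ∧
    (-l₁ < n → n < l₁ → l₁ ≤ n + (m : ℤ) → a n m = A n) ∧
    (n ≤ -l₁ → l₁ ≤ n + (m : ℤ) → a n m = qc q (-(n : ℝ)) * k₂) ∧
    (n ≤ -l₁ → -l₁ < n + (m : ℤ) → n + (m : ℤ) < l₁ →
      a n m = qc q (-(n : ℝ)) * B (n + m)) ∧
    (n + (m : ℤ) ≤ -l₁ → a n m = qc q (-(2 * (n : ℝ) + (m : ℝ))) * k₃)

/-- An `l`-stabilized family on `ℤ × ℕ` (the regions do not depend on `l`). -/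
def IsStabilizedFam (q : ℝ) (c : ℂ) (l₁ : ℤ) (e : ℤ → ℕ → ℂ) : Prop :=
  ∃ (u w : ℂ) (f v : ℤ → ℂ) (N : ℤ), 2 * l₁ < N ∧ ∀ (n : ℤ) (m : ℕ),
    (l₁ ≤ n → e n m = (c ^ 2 * (q : ℂ)) ^ n * (c * qc q (1 / 2)) ^ m * u) ∧
    (-l₁ < n → n < l₁ → N ≤ (m : ℤ) → e n m = (c * qc q (1 / 2)) ^ m * f n) ∧
    (n ≤ -l₁ → -l₁ < n + (m : ℤ) → n + (m : ℤ) < l₁ → N ≤ (m : ℤ) →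
      e n m = qc q ((m : ℝ) / 2) * c ^ (-(m : ℤ)) * v (n + m)) ∧
    (n + (m : ℤ) ≤ -l₁ → e n m = (c ^ 2 * (q : ℂ)⁻¹) ^ n * (c * qc q (-(1 / 2))) ^ m * w)

lemma norm_qc {q : ℝ} (hq : 0 < q) (x : ℝ) : ‖qc q x‖ = q ^ x := by
  rw [qc, Complex.norm_real, Real.norm_of_nonneg (Real.rpow_nonneg hq.le x)]

/-- An admissible sequence is `O(q^(m/2))`, uniformly in `m`. -/
lemma IsAdmissibleSeq.exists_norm_le {q : ℝ} (hq : 0 < q) {c : ℂ} (hc : ‖c‖ = 1) {l₁ : ℤ}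
    {d : ℕ → ℂ} (hd : IsAdmissibleSeq q c l₁ d) :
    ∃ C : ℝ, ∀ m : ℕ, ‖d m‖ ≤ C * q ^ ((m : ℝ) / 2) := by
  obtain ⟨c₁, c₂, hd⟩ := hd
  have hpos : ∀ m : ℕ, 0 < q ^ ((m : ℝ) / 2) := fun m => Real.rpow_pos_of_pos hq _
  have hsum : 0 ≤ ∑ j ∈ Finset.range l₁.toNat, ‖d j‖ / q ^ ((j : ℝ) / 2) :=
    Finset.sum_nonneg fun j _ => div_nonneg (norm_nonneg _) (hpos j).le
  refine ⟨‖c₁‖ + ‖c₂‖ + ∑ j ∈ Finset.range l₁.toNat, ‖d j‖ / q ^ ((j : ℝ) / 2), fun m => ?_⟩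
  rw [← div_le_iff₀ (hpos m)]
  by_cases hm : l₁ ≤ (m : ℤ)
  · have h : ‖d m‖ / q ^ ((m : ℝ) / 2) ≤ ‖c₁‖ + ‖c₂‖ := by
      rw [hd m hm, norm_mul, norm_qc hq, mul_div_cancel_left₀ _ (hpos m).ne']
      refine (norm_add_le _ _).trans_eq ?_
      simp [hc]
    linarith
  · have h : ‖d m‖ / q ^ ((m : ℝ) / 2) ≤
        ∑ j ∈ Finset.range l₁.toNat, ‖d j‖ / q ^ ((j : ℝ) / 2) :=
      Finset.single_le_sum (f := fun j : ℕ => ‖d j‖ / q ^ ((j : ℝ) / 2))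
        (fun j _ => div_nonneg (norm_nonneg _) (hpos j).le)
        (Finset.mem_range.2 (by omega))
    linarith [norm_nonneg c₁, norm_nonneg c₂]

/-- The pairs `(n, m)` with `n + m ≤ -l₁`, parametrized by `(k, m)` with `k = -l₁ - n - m`. -/
def lowerRegionEquiv (l₁ : ℤ) : ℕ × ℕ ≃ {p : ℤ × ℕ // p.1 + (p.2 : ℤ) ≤ -l₁} where
  toFun x := ⟨(-l₁ - x.1 - x.2, x.2), by dsimp only; omega⟩
  invFun p := ((-l₁ - p.1.1 - p.1.2).toNat, p.1.2)
  left_inv x := by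
    ext
    · dsimp only; omega
    · rfl
  right_inv p := by
    obtain ⟨⟨n, m⟩, h⟩ := p
    ext
    · dsimp only at h ⊢; omega
    · rfl

lemma norm_lower_term_le {q : ℝ} (hq0 : 0 < q) (hq1 : q < 1) {c : ℂ} (hc : ‖c‖ = 1)
    {l₁ : ℤ} (hl₁ : 0 < l₁) (l : ℤ) (w : ℂ) {d : ℕ → ℂ} {C : ℝ}
    (hd : ∀ m : ℕ, ‖d m‖ ≤ C * q ^ ((m : ℝ) / 2)) {s : ℝ} (hs : 0 < s)
    {n : ℤ} {k m : ℕ} (hn : n = -l₁ - k - m) :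
    ‖qc q (-(m : ℝ)) * d m * (c ^ 2 * (q : ℂ)⁻¹) ^ n * (c * qc q (-(1 / 2))) ^ m * w *
        (qc q (s * (-2 * (n : ℝ) - (m : ℝ) - 2 * (l : ℝ))) -
         qc q (s * (-2 * (n : ℝ) - (m : ℝ))))‖ ≤
      C * ‖w‖ * |q ^ (s * (-2 * (l : ℝ))) - 1| * (q ^ k * (q ^ s) ^ m) := by
  have hnR : (n : ℝ) = -l₁ - k - m := by rw [hn]; push_cast; ring
  have hl₁R : (0 : ℝ) < l₁ := by exact_mod_cast hl₁
  have hC : 0 ≤ C := by simpa using (norm_nonneg _).trans (hd 0)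
  have hdiff : ‖qc q (s * (-2 * (n : ℝ) - (m : ℝ) - 2 * (l : ℝ))) -
      qc q (s * (-2 * (n : ℝ) - (m : ℝ)))‖ =
      q ^ (s * (-2 * (n : ℝ) - m)) * |q ^ (s * (-2 * (l : ℝ))) - 1| := by
    have hsplit : s * (-2 * (n : ℝ) - m - 2 * l) = s * (-2 * (n : ℝ) - m) + s * (-2 * l) := by
      ring
    rw [qc, qc, ← Complex.ofReal_sub, Complex.norm_real, Real.norm_eq_abs, hsplit,
      Real.rpow_add hq0, ← mul_sub_one, abs_mul, abs_of_pos (Real.rpow_pos_of_pos hq0 _)]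
  have hnpow : ‖(c ^ 2 * (q : ℂ)⁻¹) ^ n‖ = q ^ (-(n : ℝ)) := by
    rw [norm_zpow, norm_mul, norm_pow, hc, norm_inv, Complex.norm_real,
      Real.norm_of_nonneg hq0.le, one_pow, one_mul, Real.rpow_neg hq0.le, Real.rpow_intCast,
      inv_zpow]
  have hmpow : ‖(c * qc q (-(1 / 2))) ^ m‖ = q ^ (-(m : ℝ) / 2) := by
    rw [norm_pow, norm_mul, hc, norm_qc hq0, one_mul, ← Real.rpow_mul_natCast hq0.le]
    congr 1
    ring
  have hexp : q ^ (-(m : ℝ)) * q ^ ((m : ℝ) / 2) * q ^ (-(n : ℝ)) * q ^ (-(m : ℝ) / 2) *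
      q ^ (s * (-2 * (n : ℝ) - m)) ≤ q ^ k * (q ^ s) ^ m := by
    rw [← Real.rpow_natCast q k, ← Real.rpow_mul_natCast hq0.le]
    simp only [← Real.rpow_add hq0]
    refine Real.rpow_le_rpow_of_exponent_ge hq0 hq1.le ?_
    rw [hnR]
    have : 0 ≤ s * (2 * l₁ + 2 * k) := by positivity
    linarith
  rw [norm_mul, norm_mul, norm_mul, norm_mul, norm_mul, hdiff, hnpow, hmpow, norm_qc hq0]
  calc _ ≤ q ^ (-(m : ℝ)) * (C * q ^ ((m : ℝ) / 2)) * q ^ (-(n : ℝ)) * q ^ (-(m : ℝ) / 2) *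
        ‖w‖ * (q ^ (s * (-2 * (n : ℝ) - m)) * |q ^ (s * (-2 * (l : ℝ))) - 1|) := by
        gcongr
        exact hd m
    _ = C * ‖w‖ * |q ^ (s * (-2 * (l : ℝ))) - 1| *
        (q ^ (-(m : ℝ)) * q ^ ((m : ℝ) / 2) * q ^ (-(n : ℝ)) * q ^ (-(m : ℝ) / 2) *
          q ^ (s * (-2 * (n : ℝ) - m))) := by ring
    _ ≤ _ := by gcongr

lemma hasSum_geometric_prod {a b : ℝ} (ha0 : 0 ≤ a) (ha1 : a < 1) (hb0 : 0 ≤ b) (hb1 : b < 1) :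
    HasSum (fun x : ℕ × ℕ => a ^ x.1 * b ^ x.2) ((1 - a)⁻¹ * (1 - b)⁻¹) :=
  (hasSum_geometric_of_lt_one ha0 ha1).mul (hasSum_geometric_of_lt_one hb0 hb1)
    ((summable_geometric_of_lt_one ha0 ha1).mul_of_nonneg (summable_geometric_of_lt_one hb0 hb1)
      (fun _ => pow_nonneg ha0 _) (fun _ => pow_nonneg hb0 _))

lemma tendsto_mul_inv_one_sub_rpow {q : ℝ} (hq0 : 0 < q) (hq1 : q < 1) :
    Tendsto (fun s : ℝ => s * (1 - q ^ s)⁻¹) (𝓝[>] 0) (𝓝 (-(Real.log q)⁻¹)) := by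
  have hder : HasDerivAt (fun s : ℝ => q ^ s) (Real.log q) 0 := by
    simpa using (hasDerivAt_id (0 : ℝ)).const_rpow hq0
  have h := ((hasDerivAt_iff_tendsto_slope.1 hder).mono_left
    (nhdsWithin_mono _ fun x (hx : 0 < x) => hx.ne')).inv₀ (Real.log_neg hq0 hq1).ne
  refine h.neg.congr fun s => ?_
  rw [slope_def_field, Real.rpow_zero, sub_zero, inv_div, ← div_neg, neg_sub, div_eq_mul_inv]

/-- component of claim (2) on the region `n + m ≤ -l₁`. -/
theorem stmt9 (q : ℝ) (hq0 : 0 < q) (hq1 : q < 1) (c α : ℂ)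
    (hc : ‖c‖ = 1) (hα : ‖α‖ = 1) (l₁ : ℤ) (hl₁ : 0 < l₁)
    (l : ℤ) (hl : |l| < l₁) (w : ℂ)
    (d : ℕ → ℂ) (hd : IsAdmissibleSeq q c l₁ d)
    (T : ℝ → ℤ × ℕ → ℂ)
    (hT : ∀ (s : ℝ) (n : ℤ) (m : ℕ),
      T s (n, m) = qc q (-(m : ℝ)) * d m *
        (c ^ 2 * (q : ℂ)⁻¹) ^ n * (c * qc q (-(1 / 2))) ^ m * w *
        (qc q (s * (-2 * (n : ℝ) - (m : ℝ) - 2 * (l : ℝ))) -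
         qc q (s * (-2 * (n : ℝ) - (m : ℝ))))) :
    (∀ s : ℝ, 0 < s →
      Summable fun p : {p : ℤ × ℕ // p.1 + (p.2 : ℤ) ≤ -l₁} => ‖T s p.1‖) ∧
    Tendsto (fun s : ℝ => (s : ℂ) *
        ∑' p : {p : ℤ × ℕ // p.1 + (p.2 : ℤ) ≤ -l₁}, T s p.1)
      (𝓝[>] (0 : ℝ)) (𝓝 0) := by
  obtain ⟨C, hdC⟩ := hd.exists_norm_le hq0 hc
  have hle : ∀ s : ℝ, 0 < s → ∀ x : ℕ × ℕ, ‖T s (lowerRegionEquiv l₁ x).1‖ ≤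
      C * ‖w‖ * |q ^ (s * (-2 * (l : ℝ))) - 1| * (q ^ x.1 * (q ^ s) ^ x.2) := by
    intro s hs x
    change ‖T s (-l₁ - x.1 - x.2, x.2)‖ ≤ _
    rw [hT]
    exact norm_lower_term_le hq0 hq1 hc hl₁ l w hdC hs rfl
  have hgeom : ∀ s : ℝ, 0 < s → HasSum (fun x : ℕ × ℕ =>
      C * ‖w‖ * |q ^ (s * (-2 * (l : ℝ))) - 1| * (q ^ x.1 * (q ^ s) ^ x.2))
      (C * ‖w‖ * |q ^ (s * (-2 * (l : ℝ))) - 1| * ((1 - q)⁻¹ * (1 - q ^ s)⁻¹)) := fun s hs =>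
    (hasSum_geometric_prod hq0.le hq1 (Real.rpow_nonneg hq0.le s)
      (Real.rpow_lt_one hq0.le hq1 hs)).mul_left _
  refine ⟨fun s hs => ?_, ?_⟩
  · exact (lowerRegionEquiv l₁).summable_iff.1
      (Summable.of_nonneg_of_le (fun _ => norm_nonneg _) (hle s hs) (hgeom s hs).summable)
  · have hzero : Tendsto (fun s : ℝ => |q ^ (s * (-2 * (l : ℝ))) - 1|) (𝓝[>] 0) (𝓝 0) := by
      have hcont : Continuous fun s : ℝ => |q ^ (s * (-2 * (l : ℝ))) - 1| :=
        ((Real.continuous_const_rpow hq0.ne').comp (continuous_mul_const _)).sub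
          continuous_const |>.abs
      simpa using (hcont.tendsto 0).mono_left nhdsWithin_le_nhds
    have hbound := ((hzero.mul (tendsto_mul_inv_one_sub_rpow hq0 hq1)).const_mul
      (C * ‖w‖ * (1 - q)⁻¹))
    rw [zero_mul, mul_zero] at hbound
    refine squeeze_zero_norm' ?_ hbound
    filter_upwards [self_mem_nhdsWithin] with s (hs : 0 < s)
    rw [norm_mul, Complex.norm_real, Real.norm_of_nonneg hs.le,
      ← (lowerRegionEquiv l₁).tsum_eq fun p => T s p.1]
    calc _ ≤ s * (C * ‖w‖ * |q ^ (s * (-2 * (l : ℝ))) - 1| * ((1 - q)⁻¹ * (1 - q ^ s)⁻¹)) := by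
          gcongr
          exact tsum_of_norm_bounded (hgeom s hs) (hle s hs)
      _ = _ := by ring
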